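/- arXiv:2507.15980 — 2 statements merged into one kernel-verified Lean document; each statement's English description precedes it below -/
import Mathlib

section
/- For every σ > 2, every compact set K contained in ℝ \ 𝓟𝓜 (the complement of the Perez-Marco set), and every Borel probability measure μ with support contained in K, the energy integral I²_σ(μ) = ∬_{K×K} k²_σ(x,ξ) dμ(x) dμ(ξ) is equal to +∞ (equivalently, K has zero C_σ-capacity with respect to the kernel k²_σ). -/
open MeasureTheory Filter ENNReal

/-- The `n`-th denominator of the continued fraction expansion of `α`. -/
noncomputable def cfDen (α : ℝ) (n : ℕ) : ℝ := (GenContFract.of α).dens n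

/-- The Perez-Marco set: irrational numbers whose continued fraction denominators satisfy
`∑_{n≥1} (ln ln Q_{n+1})/Q_n < +∞`. -/
def PerezMarcoSet : Set ℝ :=
  {α | Irrational α ∧
    Summable (fun n : ℕ => Real.log (Real.log (cfDen α (n + 2))) / cfDen α (n + 1))}

/-- The kernel `k²_σ(x,ξ) = (ln ln(e + 1/|x−ξ|))² · (ln ln ln(e³ + 1/|x−ξ|))^σ`, with value
`⊤` on the diagonal. -/
noncomputable def pmKernel (σ : ℝ) (x ξ : ℝ) : ℝ≥0∞ :=
  if x = ξ then ⊤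
  else ENNReal.ofReal ((Real.log (Real.log (Real.exp 1 + 1 / |x - ξ|))) ^ 2 *
    (Real.log (Real.log (Real.log (Real.exp 3 + 1 / |x - ξ|)))) ^ σ)

/-- The threshold `2 ^ k / √(k + 1)` for `ln ln (1 / r)` at denominators of size about `2 ^ k`. -/
noncomputable def approxLevel (k : ℕ) : ℝ := 2 ^ k / √(k + 1)

/-- The radius whose inverse has iterated logarithm about `approxLevel k`. -/
noncomputable def approxRadius (k : ℕ) : ℝ := Real.exp (-Real.exp (approxLevel k)) / 2

/-- The points within `approxRadius k` of a fraction of denominator at most `2 ^ (k + 1)`. -/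
def wellApprox (k : ℕ) : Set ℝ :=
  {x | ∃ q p : ℤ, 1 ≤ q ∧ q ≤ 2 ^ (k + 1) ∧ |x - p / q| < approxRadius k}

/-- The potential of `μ` with respect to the kernel `k²_σ`. -/
noncomputable def pmPotential (σ : ℝ) (μ : Measure ℝ) (x : ℝ) : ℝ≥0∞ :=
  ∫⁻ ξ, pmKernel σ x ξ ∂μ

lemma approxRadius_pos (k : ℕ) : 0 < approxRadius k := by
  unfold approxRadius; positivity

lemma approxRadius_le_half (k : ℕ) : approxRadius k ≤ 1 / 2 := by
  unfold approxRadius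
  have : Real.exp (-Real.exp (approxLevel k)) ≤ 1 :=
    Real.exp_le_one_iff.2 (neg_nonpos.2 (Real.exp_pos _).le)
  linarith

lemma add_one_le_two_pow (k : ℕ) : (k + 1 : ℝ) ≤ 2 ^ k := by
  exact_mod_cast Nat.lt_two_pow_self (n := k)

lemma approxLevel_sq (k : ℕ) : approxLevel k ^ 2 = 4 ^ k / (k + 1) := by
  unfold approxLevel
  rw [div_pow, Real.sq_sqrt (by positivity), ← pow_mul, mul_comm k 2, pow_mul]
  norm_num

lemma one_le_approxLevel (k : ℕ) : 1 ≤ approxLevel k := by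
  unfold approxLevel
  rw [one_le_div (by positivity), Real.sqrt_le_iff]
  refine ⟨by positivity, (add_one_le_two_pow k).trans ?_⟩
  exact le_self_pow₀ (one_le_pow₀ (by norm_num)) (by norm_num)

lemma div_four_le_log_approxLevel (k : ℕ) : (k / 4 : ℝ) ≤ Real.log (approxLevel k) := by
  have h1 : (2 : ℝ) ^ k ≤ approxLevel k ^ 2 := by
    rw [approxLevel_sq, le_div_iff₀ (by positivity)]
    calc (2 : ℝ) ^ k * (k + 1) ≤ 2 ^ k * 2 ^ k := by gcongr; exact add_one_le_two_pow k
      _ = 4 ^ k := by rw [← mul_pow]; norm_num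
  have h2 := Real.log_le_log (by positivity) h1
  rw [Real.log_pow, Real.log_pow] at h2
  have h3 : (1 / 2 : ℝ) ≤ Real.log 2 := by linarith [Real.log_two_gt_d9]
  have h4 : (k : ℝ) * (1 / 2) ≤ k * Real.log 2 := by gcongr
  push_cast at h2
  linarith

/-! ### Continued fraction denominators -/

lemma exists_int_contsAux (x : ℝ) (n : ℕ) :
    ∃ a b : ℤ, (GenContFract.of x).contsAux n = ⟨(a : ℝ), (b : ℝ)⟩ := by
  induction n using Nat.twoStepInduction with
  | zero => exact ⟨1, 0, by simp [GenContFract.contsAux]⟩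
  | one => exact ⟨⌊x⌋, 1, by simp [GenContFract.contsAux]⟩
  | more n h0 h1 =>
    obtain ⟨a, b, hab⟩ := h0
    obtain ⟨c, d, hcd⟩ := h1
    rcases hs : (GenContFract.of x).s.get? n with _ | gp
    · exact ⟨c, d, by simpa [GenContFract.contsAux, hs] using hcd⟩
    · obtain ⟨h1, z, hz⟩ := GenContFract.of_partNum_eq_one_and_exists_int_partDen_eq hs
      refine ⟨z * c + a, z * d + b, ?_⟩
      rw [GenContFract.contsAux_recurrence hs hab hcd, h1, hz]
      push_cast
      simp

lemma not_terminatedAt_of_irrational {x : ℝ} (hx : Irrational x) (n : ℕ) :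
    ¬(GenContFract.of x).TerminatedAt n := by
  intro h
  obtain ⟨q, hq⟩ := (GenContFract.terminates_iff_rat x).1 ⟨n, h⟩
  exact hx ⟨q, hq.symm⟩

lemma three_halves_pow_le_cfDen {x : ℝ} (hx : Irrational x) (n : ℕ) :
    (3 / 2 : ℝ) ^ n ≤ cfDen x (n + 1) := by
  have hfib : (3 / 2 : ℝ) ^ n ≤ Nat.fib (n + 2) := by
    induction n using Nat.twoStepInduction with
    | zero => simp
    | one => norm_num [Nat.fib_add_two]
    | more n h0 h1 =>
      rw [Nat.fib_add_two]
      push_cast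
      have : (0 : ℝ) < (3 / 2) ^ n := by positivity
      rw [pow_succ] at h1 ⊢
      rw [pow_succ]
      linarith
  exact hfib.trans
    (GenContFract.succ_nth_fib_le_of_nth_den (Or.inr (not_terminatedAt_of_irrational hx _)))

lemma abs_sub_conv_le {x : ℝ} (hx : Irrational x) (n : ℕ) :
    ∃ q p : ℤ, (q : ℝ) = cfDen x n ∧ |x - p / q| ≤ 1 / (cfDen x n * cfDen x (n + 1)) := by
  obtain ⟨p, q, h⟩ := exists_int_contsAux x (n + 1)
  have hq : (q : ℝ) = cfDen x n := by
    rw [cfDen, GenContFract.den_eq_conts_b, GenContFract.nth_cont_eq_succ_nth_contAux, h]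
  refine ⟨q, p, hq, ?_⟩
  have hc : (GenContFract.of x).convs n = p / q := by
    rw [GenContFract.conv_eq_conts_a_div_conts_b, GenContFract.nth_cont_eq_succ_nth_contAux, h]
  rw [← hc]
  exact GenContFract.abs_sub_convs_le (not_terminatedAt_of_irrational hx n)

lemma log_log_cfDen_le {x : ℝ} (hx : Irrational x) {k n : ℕ} (hxk : x ∉ wellApprox k)
    (hn : cfDen x (n + 1) ≤ 2 ^ (k + 1)) :
    Real.log (Real.log (cfDen x (n + 2))) ≤ approxLevel k + 1 := by
  obtain ⟨q, p, hq, hp⟩ := abs_sub_conv_le hx (n + 1)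
  have hQ1 : 1 ≤ cfDen x (n + 1) :=
    (one_le_pow₀ (by norm_num)).trans (three_halves_pow_le_cfDen hx n)
  have hQ2 : 1 < cfDen x (n + 2) :=
    (one_lt_pow₀ (by norm_num) n.succ_ne_zero).trans_le (three_halves_pow_le_cfDen hx (n + 1))
  have hr : approxRadius k ≤ |x - p / q| := by
    by_contra! hlt
    refine hxk ⟨q, p, ?_, ?_, hlt⟩
    · rw [← hq] at hQ1; exact_mod_cast hQ1
    · rw [← hq] at hn; exact_mod_cast hn
  have h1 : approxRadius k ≤ 1 / cfDen x (n + 2) := by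
    refine (hr.trans hp).trans (one_div_le_one_div_of_le (by linarith) ?_)
    exact le_mul_of_one_le_left (by linarith) hQ1
  set t := approxLevel k with ht
  have h2 : cfDen x (n + 2) ≤ 2 * Real.exp (Real.exp t) := by
    rw [le_div_iff₀ (by linarith), approxRadius, ← ht, Real.exp_neg, div_mul_eq_mul_div,
      inv_mul_eq_div, div_div, div_le_one (by positivity)] at h1
    linarith
  have h3 : Real.log (cfDen x (n + 2)) ≤ Real.exp (t + 1) := by
    have h4 := Real.log_le_log (by linarith) h2
    rw [Real.log_mul (by norm_num) (by positivity), Real.log_exp] at h4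
    have h5 : Real.log 2 ≤ 1 := by linarith [Real.log_two_lt_d9]
    have h6 : 1 ≤ Real.exp t := Real.one_le_exp (by linarith [one_le_approxLevel k])
    have h7 : 2 ≤ Real.exp 1 := by linarith [Real.exp_one_gt_d9]
    rw [Real.exp_add]
    nlinarith
  have h8 := Real.log_le_log (Real.log_pos hQ2) h3
  rwa [Real.log_exp] at h8

/-! ### Summability from the iterated logarithm bound -/

lemma log_log_div_le {Q Q' : ℝ} {k : ℕ} (hQ : 2 ^ k ≤ Q) (hQk : Q < 2 ^ (k + 1)) (h1 : 1 < Q)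
    (hQQ' : Q ≤ Q') (h : Real.log (Real.log Q') ≤ approxLevel k + 1) :
    Real.log (Real.log Q') / Q ≤
      8 / √Q + 4 * (1 / √(Real.log Q) - 1 / √(Real.log Q')) := by
  have hL : 0 < Real.log Q := Real.log_pos h1
  have hLL : Real.log Q ≤ Real.log Q' := Real.log_le_log (by linarith) hQQ'
  have hG : 1 / √(Real.log Q') ≤ 1 / √(Real.log Q) :=
    one_div_le_one_div_of_le (Real.sqrt_pos.2 hL) (Real.sqrt_le_sqrt hLL)
  have hQ0 : 0 < Q := by linarith
  have hsQ : 0 < √Q := Real.sqrt_pos.2 hQ0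
  rcases le_total (Real.log Q') (4 * Real.log Q) with hc | hc
  · have h2 : Real.log (Real.log Q') ≤ 4 * Real.log Q := by
      linarith [Real.log_le_sub_one_of_pos (hL.trans_le hLL)]
    have h3 : Real.log Q ≤ 2 * √Q := by
      have := Real.log_le_sub_one_of_pos hsQ
      rw [Real.log_sqrt hQ0.le] at this
      linarith
    have h4 : Real.log (Real.log Q') / Q ≤ 8 / √Q := by
      rw [div_le_div_iff₀ hQ0 hsQ]
      nlinarith [Real.mul_self_sqrt hQ0.le]
    linarith
  · have hk : (0 : ℝ) < k + 1 := by positivity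
    have hs : 0 < √(k + 1 : ℝ) := Real.sqrt_pos.2 hk
    have h2k : (0 : ℝ) < 2 ^ k := by positivity
    have h2 : Real.log (Real.log Q') / Q ≤ 2 / √(k + 1 : ℝ) := by
      have hlev : approxLevel k + 1 ≤ 2 * approxLevel k := by linarith [one_le_approxLevel k]
      calc Real.log (Real.log Q') / Q ≤ 2 * approxLevel k / Q := by gcongr; linarith
        _ ≤ 2 * approxLevel k / 2 ^ k := by
          have := one_le_approxLevel k
          gcongr
        _ = 2 / √(k + 1 : ℝ) := by unfold approxLevel; field_simp
    have h3 : Real.log Q ≤ k + 1 := by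
      have := Real.log_le_log hQ0 hQk.le
      rw [Real.log_pow] at this
      push_cast at this
      nlinarith [Real.log_two_lt_d9]
    have h4 : 2 / √(k + 1 : ℝ) ≤ 2 * (1 / √(Real.log Q)) := by
      rw [mul_one_div]
      have := Real.sqrt_pos.2 hL
      gcongr
    have h5 : 1 / √(Real.log Q') ≤ 1 / √(Real.log Q) / 2 := by
      have h6 : 2 * √(Real.log Q) ≤ √(Real.log Q') := by
        refine Real.le_sqrt_of_sq_le ?_
        rw [mul_pow, Real.sq_sqrt hL.le]
        linarith
      have h7 := Real.sqrt_pos.2 hL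
      rw [div_div]
      refine one_div_le_one_div_of_le (by positivity) (by linarith)
    have : 0 < 8 / √Q := by positivity
    linarith

lemma Antitone.summable_sub_succ {G : ℕ → ℝ} (hG : Antitone G) (h0 : ∀ n, 0 ≤ G n) :
    Summable fun n => G n - G (n + 1) := by
  refine summable_of_sum_range_le (c := G 0) (fun n => sub_nonneg.2 (hG n.le_succ)) fun n => ?_
  rw [Finset.sum_range_sub']
  linarith [h0 n]

lemma summable_log_log_div {Q : ℕ → ℝ} (hmono : Monotone Q) (hgrow : ∀ n, (3 / 2 : ℝ) ^ n ≤ Q n)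
    (h : ∀ᶠ k in atTop, ∀ n, Q n < 2 ^ (k + 1) →
      Real.log (Real.log (Q (n + 1))) ≤ approxLevel k + 1) :
    Summable fun n => Real.log (Real.log (Q (n + 1))) / Q n := by
  obtain ⟨k₀, hk₀⟩ := eventually_atTop.1 h
  have htend : Tendsto Q atTop atTop :=
    tendsto_atTop_mono hgrow (tendsto_pow_atTop_atTop_of_one_lt (by norm_num))
  obtain ⟨N, hN⟩ := eventually_atTop.1 (htend.eventually_ge_atTop (2 ^ (k₀ + 2)))
  have hge4 : ∀ n, 4 ≤ Q (n + N) := fun n => by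
    have h1 : (1 : ℝ) ≤ 2 ^ k₀ := one_le_pow₀ (by norm_num)
    have h2 := hN (n + N) (by omega)
    rw [pow_add] at h2
    linarith
  rw [← summable_nat_add_iff N]
  have hS1 : Summable fun n : ℕ => 8 / √(Q (n + N)) := by
    have hr : √(2 / 3 : ℝ) < 1 := by
      rw [Real.sqrt_lt' one_pos]; norm_num
    refine Summable.of_nonneg_of_le (fun n => by positivity) (fun n => ?_)
      ((summable_geometric_of_lt_one (Real.sqrt_nonneg _) hr).mul_left 8)
    have h1 : (3 / 2 : ℝ) ^ n ≤ Q (n + N) := (hgrow n).trans (hmono (by omega))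
    have h2 : √(2 / 3 : ℝ) ^ n = 1 / √((3 / 2) ^ n) := by
      rw [one_div, ← Real.sqrt_inv, ← inv_pow, Real.sqrt_eq_rpow, Real.sqrt_eq_rpow,
        ← Real.rpow_natCast, ← Real.rpow_mul (by norm_num), ← Real.rpow_natCast,
        ← Real.rpow_mul (by norm_num), mul_comm]
      norm_num
    rw [h2, mul_one_div]
    gcongr
  have hlog : ∀ n, 1 ≤ Real.log (Q (n + N)) := fun n => by
    rw [Real.le_log_iff_exp_le (by linarith [hge4 n])]
    linarith [hge4 n, Real.exp_one_lt_d9]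
  have hS2 : Summable fun n : ℕ =>
      1 / √(Real.log (Q (n + N))) - 1 / √(Real.log (Q (n + 1 + N))) := by
    refine Antitone.summable_sub_succ (G := fun n => 1 / √(Real.log (Q (n + N))))
      (fun a b hab => ?_) fun n => by positivity
    have h1 := hlog a
    have h2 : Real.log (Q (a + N)) ≤ Real.log (Q (b + N)) :=
      Real.log_le_log (by linarith [hge4 a]) (hmono (by omega))
    exact one_div_le_one_div_of_le (Real.sqrt_pos.2 (by linarith)) (Real.sqrt_le_sqrt h2)
  refine Summable.of_nonneg_of_le (fun n => ?_) (fun n => ?_) (hS1.add (hS2.mul_left 4))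
  · have h1 := hlog (n + 1)
    have h2 := hge4 n
    rw [add_right_comm] at h1
    exact div_nonneg (Real.log_nonneg h1) (by linarith)
  · have h4 := hge4 n
    obtain ⟨k, hk1, hk2⟩ := exists_nat_pow_near (x := Q (n + N)) (y := 2) (by linarith)
      (by norm_num)
    have hk : k₀ ≤ k := by
      have h5 := (hN (n + N) (by omega)).trans_lt hk2
      have := (pow_lt_pow_iff_right₀ (by norm_num : (1 : ℝ) < 2)).1 h5
      omega
    have := log_log_div_le hk1 hk2 (by linarith) (hmono (Nat.le_succ (n + N)))
      (hk₀ k hk _ hk2)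
    rwa [add_right_comm n 1 N]

lemma mem_perezMarcoSet_of_eventually_notMem {x : ℝ} (hx : ∀ᶠ k in atTop, x ∉ wellApprox k) :
    x ∈ PerezMarcoSet := by
  have hirr : Irrational x := by
    rintro ⟨q, rfl⟩
    obtain ⟨k, hk, hqk⟩ := (hx.and (eventually_ge_atTop q.den)).exists
    refine hk ⟨q.den, q.num, by exact_mod_cast q.pos, ?_, ?_⟩
    · have h1 : q.den ≤ 2 ^ (k + 1) := by
        have := Nat.lt_two_pow_self (n := k + 1)
        omega
      exact_mod_cast h1
    · have : ((q.num : ℝ) / ((q.den : ℤ) : ℝ)) = (q : ℝ) := by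
        rw [Int.cast_natCast]; exact_mod_cast Rat.num_div_den q
      rw [this, sub_self, abs_zero]
      exact approxRadius_pos k
  refine ⟨hirr, summable_log_log_div (Q := fun n => cfDen x (n + 1))
    (monotone_nat_of_le_succ fun n => GenContFract.of_den_mono)
    (three_halves_pow_le_cfDen hirr) ?_⟩
  filter_upwards [hx] with k hk n hn
  exact log_log_cfDen_le hirr hk hn.le

/-! ### Potentials -/

lemma measurable_pmKernel (σ : ℝ) : Measurable (Function.uncurry (pmKernel σ)) := by
  unfold pmKernel Function.uncurry
  refine Measurable.ite (measurableSet_eq_fun measurable_fst measurable_snd) measurable_const ?_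
  fun_prop

lemma measurable_pmPotential (σ : ℝ) (μ : Measure ℝ) [SFinite μ] :
    Measurable (pmPotential σ μ) :=
  (measurable_pmKernel σ).lintegral_prod_right'

lemma le_pmKernel {σ t x ξ : ℝ} (hσ : 0 ≤ σ) (ht : 1 ≤ t)
    (hxξ : |x - ξ| ≤ Real.exp (-Real.exp t)) :
    ENNReal.ofReal (t ^ 2 * Real.log t ^ σ) ≤ pmKernel σ x ξ := by
  unfold pmKernel
  split_ifs with h
  · exact le_top
  · have hpos : 0 < |x - ξ| := abs_pos.2 (sub_ne_zero.2 h)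
    have h1 : Real.exp (Real.exp t) ≤ 1 / |x - ξ| := by
      rw [le_one_div (by positivity) hpos, one_div, ← Real.exp_neg]
      exact hxξ
    have key : ∀ a : ℝ, 0 < a → t ≤ Real.log (Real.log (a + 1 / |x - ξ|)) := fun a ha => by
      have h2 : Real.exp t ≤ Real.log (a + 1 / |x - ξ|) := by
        rw [Real.le_log_iff_exp_le (by positivity)]; linarith
      rwa [Real.le_log_iff_exp_le ((Real.exp_pos t).trans_le h2)]
    have h2 := key _ (Real.exp_pos 1)
    have h3 := Real.log_le_log (by linarith) (key _ (Real.exp_pos 3))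
    have h4 := Real.log_nonneg ht
    gcongr

lemma measure_closedBall_mul_le {σ : ℝ} (hσ : 0 ≤ σ) (μ : Measure ℝ) (x : ℝ) (k : ℕ) :
    ENNReal.ofReal (approxLevel k ^ 2 * Real.log (approxLevel k) ^ σ) *
      μ (Metric.closedBall x (2 * approxRadius k)) ≤ pmPotential σ μ x := by
  rw [← setLIntegral_const]
  refine (setLIntegral_mono' Metric.isClosed_closedBall.measurableSet fun ξ hξ => ?_).trans
    (setLIntegral_le_lintegral _ _)
  refine le_pmKernel hσ (one_le_approxLevel k) ?_
  rw [Metric.mem_closedBall, dist_comm, Real.dist_eq, approxRadius] at hξ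
  linarith

/-- On the set where the potential is at most `m`, the part of `wellApprox k` in a bounded interval
has small measure. -/
lemma measure_wellApprox_inter_le {σ : ℝ} (hσ : 0 ≤ σ) (μ : Measure ℝ) (M m k : ℕ) :
    μ (wellApprox (k + 1) ∩ {x : ℝ | |x| ≤ M ∧ pmPotential σ μ x ≤ m}) ≤
      ENNReal.ofReal (4 * (2 * M + 3) * m * 4 ^ σ * 2 * (1 / ((k + 1 : ℕ) : ℝ) ^ (σ - 1))) := by
  set K := k + 1 with hK
  set F := {x : ℝ | |x| ≤ M ∧ pmPotential σ μ x ≤ m} with hF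
  set A : ℤ := 2 ^ (K + 1) * (M + 1) with hA
  set S := Finset.Icc (1 : ℤ) (2 ^ (K + 1)) ×ˢ Finset.Icc (-A) A with hS
  set c : ℝ := 4 ^ K / (K + 1) * (K / 4) ^ σ with hc
  have hKpos : (0 : ℝ) < K := by rw [hK]; positivity
  have hcpos : 0 < c := by positivity
  have hcle : c ≤ approxLevel K ^ 2 * Real.log (approxLevel K) ^ σ := by
    rw [approxLevel_sq, hc]
    gcongr
    exact div_four_le_log_approxLevel K
  have hcover : wellApprox K ∩ F ⊆
      ⋃ i ∈ S, Metric.ball ((i.2 : ℝ) / i.1) (approxRadius K) ∩ F := by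
    rintro x ⟨⟨q, p, hq1, hq2, hx⟩, hxF⟩
    refine Set.mem_iUnion₂.2 ⟨(q, p), ?_, by rwa [Metric.mem_ball, Real.dist_eq], hxF⟩
    have hq0 : (1 : ℝ) ≤ q := by exact_mod_cast hq1
    have hpA : |p| ≤ A := by
      have h1 : |(p : ℝ) / q| ≤ M + 1 := by
        have h2 := abs_sub_abs_le_abs_sub ((p : ℝ) / q) x
        rw [abs_sub_comm] at h2
        linarith [hxF.1, approxRadius_le_half K]
      rw [abs_div, abs_of_pos (by linarith : (0 : ℝ) < q), div_le_iff₀ (by linarith)] at h1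
      have h3 : |p| ≤ (M + 1) * q := by exact_mod_cast h1
      refine h3.trans ?_
      rw [hA, mul_comm]
      gcongr
    simpa [hS, hq1, hq2] using abs_le.1 hpA
  have hball : ∀ i ∈ S, μ (Metric.ball ((i.2 : ℝ) / i.1) (approxRadius K) ∩ F) ≤
      ENNReal.ofReal (m / c) := by
    intro i _
    rcases (Metric.ball ((i.2 : ℝ) / i.1) (approxRadius K) ∩ F).eq_empty_or_nonempty with he | hne
    · simp [he]
    · obtain ⟨x, hx, hxF⟩ := hne
      have hsub : Metric.ball ((i.2 : ℝ) / i.1) (approxRadius K) ∩ F ⊆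
          Metric.closedBall x (2 * approxRadius K) := fun y hy => by
        rw [Metric.mem_closedBall]
        have h1 := dist_triangle_right y x ((i.2 : ℝ) / i.1)
        have h2 := Metric.mem_ball.1 hx
        have h3 := Metric.mem_ball.1 hy.1
        linarith
      rw [ENNReal.ofReal_div_of_pos hcpos, ENNReal.ofReal_natCast,
        ENNReal.le_div_iff_mul_le (by simp [hcpos]) (by simp), mul_comm]
      refine le_trans ?_ ((measure_closedBall_mul_le hσ μ x K).trans hxF.2)
      gcongr
  have hcard : (S.card : ℝ) ≤ 4 ^ K * (4 * (2 * M + 3)) := by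
    have h1 : (S.card : ℤ) = 2 ^ (K + 1) * (2 * A + 1) := by
      have hA0 : 0 ≤ A := by positivity
      have h2 : (0 : ℤ) < 2 ^ (K + 1) := by positivity
      rw [hS, Finset.card_product, Int.card_Icc, Int.card_Icc]
      push_cast
      rw [Int.toNat_of_nonneg (by linarith), Int.toNat_of_nonneg (by linarith)]
      ring
    have h3 : (S.card : ℝ) = 2 ^ (K + 1) * (2 * (2 ^ (K + 1) * (M + 1)) + 1) := by
      have := congrArg (Int.cast (R := ℝ)) h1
      rw [hA] at this
      exact_mod_cast this
    have h4 : (1 : ℝ) ≤ 2 ^ (K + 1) := one_le_pow₀ (by norm_num)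
    have h5 : (4 : ℝ) ^ K * 4 = 2 ^ (K + 1) * 2 ^ (K + 1) := by
      rw [← mul_pow, ← pow_succ]; norm_num
    rw [h3, ← mul_assoc ((4 : ℝ) ^ K), h5, mul_assoc]
    gcongr
    linarith
  calc μ (wellApprox K ∩ F)
      ≤ ∑ i ∈ S, μ (Metric.ball ((i.2 : ℝ) / i.1) (approxRadius K) ∩ F) :=
        (measure_mono hcover).trans (measure_biUnion_finset_le _ _)
    _ ≤ S.card • ENNReal.ofReal (m / c) := Finset.sum_le_card_nsmul _ _ _ hball
    _ = ENNReal.ofReal (S.card * (m / c)) := by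
        rw [nsmul_eq_mul, ENNReal.ofReal_mul (by positivity), ENNReal.ofReal_natCast]
    _ ≤ _ := by
        refine ENNReal.ofReal_le_ofReal ?_
        have hK1 : (K + 1 : ℝ) ≤ 2 * K := by rw [hK]; push_cast; linarith
        calc (S.card : ℝ) * (m / c) ≤ 4 ^ K * (4 * (2 * M + 3)) * (m / c) := by gcongr
          _ = 4 * (2 * M + 3) * m * 4 ^ σ * (K + 1) / (K : ℝ) ^ σ := by
            rw [hc, Real.div_rpow hKpos.le (by norm_num)]
            field_simp
          _ ≤ 4 * (2 * M + 3) * m * 4 ^ σ * (2 * K) / (K : ℝ) ^ σ := by gcongr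
          _ = _ := by
            rw [Real.rpow_sub_one hKpos.ne']
            field_simp

lemma ae_mem_perezMarcoSet_of_pmPotential_le {σ : ℝ} (hσ : 2 < σ) (μ : Measure ℝ) (M m : ℕ) :
    ∀ᵐ x : ℝ ∂μ, |x| ≤ M → pmPotential σ μ x ≤ m → x ∈ PerezMarcoSet := by
  have hsum : ∑' k, μ (wellApprox (k + 1) ∩ {x : ℝ | |x| ≤ M ∧ pmPotential σ μ x ≤ m}) ≠ ⊤ := by
    refine ne_top_of_le_ne_top ?_
      (ENNReal.tsum_le_tsum fun k => measure_wellApprox_inter_le (by linarith) μ M m k)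
    refine Summable.tsum_ofReal_ne_top (Summable.mul_left _ ?_)
    exact (summable_nat_add_iff (f := fun n : ℕ => 1 / (n : ℝ) ^ (σ - 1)) 1).2
      (Real.summable_one_div_nat_rpow.2 (by linarith))
  filter_upwards [ae_eventually_notMem hsum] with x hx hxM hxm
  refine mem_perezMarcoSet_of_eventually_notMem ?_
  rw [← map_add_atTop_eq_nat 1, eventually_map]
  filter_upwards [hx] with k hk hmem using hk ⟨hmem, hxM, hxm⟩

/-- For every `σ > 2`, every compact `K ⊆ ℝ \ 𝓟𝓜` and every Borel probability measure `μ`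
supported in `K`, the energy `I²_σ(μ)` is infinite; i.e. `K` has zero `C_σ`-capacity with
respect to the kernel `k²_σ`. -/
theorem perezMarco_complement_zero_capacity (σ : ℝ) (hσ : 2 < σ)
    (K : Set ℝ) (hK : IsCompact K) (hKsub : K ⊆ PerezMarcoSetᶜ)
    (μ : Measure ℝ) [IsProbabilityMeasure μ] (hμK : μ Kᶜ = 0) :
    ∫⁻ x, ∫⁻ ξ, pmKernel σ x ξ ∂μ ∂μ = ⊤ := by
  by_contra hE
  have hfin : ∀ᵐ x ∂μ, pmPotential σ μ x < ⊤ := ae_lt_top (measurable_pmPotential σ μ) hE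
  obtain ⟨R, hR⟩ := hK.isBounded.exists_norm_le
  obtain ⟨M, hM⟩ := exists_nat_ge R
  have hall : ∀ᵐ x : ℝ ∂μ, ∀ m : ℕ, |x| ≤ M → pmPotential σ μ x ≤ m → x ∈ PerezMarcoSet :=
    ae_all_iff.2 fun m => ae_mem_perezMarcoSet_of_pmPotential_le hσ μ M m
  have hKae : ∀ᵐ x ∂μ, x ∈ K := hμK
  obtain ⟨x, hx, hxall, hxK⟩ := (hfin.and (hall.and hKae)).exists
  obtain ⟨m, hm⟩ := ENNReal.exists_nat_gt hx.ne
  exact hKsub hxK (hxall m ((hR x hxK).trans hM) hm.le)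
end

section
/- Let α be an irrational number with continued fraction denominators Q_n, let ε > 0, and let 𝒩′ = { n ∈ ℕ : (ln ln ln Q_{n+1})^{2+4ε} < (ln Q_n)^{2+3ε} }. Then ∑_{n ∈ 𝒩′} (ln ln Q_{n+1})/Q_n < +∞. -/
open MeasureTheory Filter

/-- The denominators of the continued fraction of an irrational number grow exponentially. -/
lemma pow_le_cfDen {α : ℝ} (hα : Irrational α) (n : ℕ) :
    (16 / 25 : ℝ) * (25 / 16) ^ n ≤ cfDen α n := by
  have hfib : ∀ m : ℕ, (25 / 16 : ℝ) ^ m ≤ 25 / 16 * (Nat.fib (m + 1) : ℝ) := by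
    intro m
    induction m using Nat.twoStepInduction with
    | zero => norm_num
    | one => norm_num
    | more m h0 h1 =>
      have hpos : (0 : ℝ) < (25 / 16) ^ m := by positivity
      rw [Nat.fib_add_two (n := m + 1)]
      push_cast
      rw [pow_succ] at h1
      rw [pow_succ, pow_succ]
      linarith
  have hden : (Nat.fib (n + 1) : ℝ) ≤ cfDen α n := by
    refine GenContFract.succ_nth_fib_le_of_nth_den (Or.inr fun hterm => ?_)
    obtain ⟨q, hq⟩ := GenContFract.exists_rat_eq_of_terminates ⟨_, hterm⟩
    exact hα ⟨q, hq.symm⟩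
  linarith [hfib n]

lemma tendsto_cfDen_atTop {α : ℝ} (hα : Irrational α) : Tendsto (cfDen α) atTop atTop :=
  tendsto_atTop_mono (pow_le_cfDen hα)
    ((tendsto_pow_atTop_atTop_of_one_lt (by norm_num)).const_mul_atTop (by norm_num))

lemma eventually_rpow_le_half {θ : ℝ} (hθ : θ < 1) : ∀ᶠ x : ℝ in atTop, x ^ θ ≤ x / 2 := by
  have h := tendsto_rpow_neg_atTop (sub_pos.mpr hθ)
  filter_upwards [h.eventually_le_const (show (0 : ℝ) < 1 / 2 by norm_num),
    eventually_gt_atTop 0] with x hx hx0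
  rw [neg_sub, Real.rpow_sub_one hx0.ne', div_le_iff₀ hx0] at hx
  linarith

/-- For an irrational `α` and `ε > 0`, the sum of `(ln ln Q_{n+1})/Q_n` over the set
`𝒩′ = {n : (ln ln ln Q_{n+1})^{2+4ε} < (ln Q_n)^{2+3ε}}` is finite. -/
theorem perezMarco_exceptional_set_summable (α : ℝ) (hα : Irrational α) (ε : ℝ) (hε : 0 < ε) :
    Summable (fun n : {n : ℕ //
        (Real.log (Real.log (Real.log (cfDen α (n + 1))))) ^ (2 + 4 * ε) <
          (Real.log (cfDen α n)) ^ (2 + 3 * ε)} =>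
      Real.log (Real.log (cfDen α ((n : ℕ) + 1))) / cfDen α (n : ℕ)) := by
  set S : Set ℕ := {n : ℕ | (Real.log (Real.log (Real.log (cfDen α (n + 1))))) ^ (2 + 4 * ε) <
    (Real.log (cfDen α n)) ^ (2 + 3 * ε)} with hS
  let f : ℕ → ℝ := fun n => Real.log (Real.log (cfDen α (n + 1))) / cfDen α n
  suffices h : Summable (S.indicator f) from summable_subtype_iff_indicator.mpr h
  have hgeom : Summable fun n : ℕ => (5 / 4 : ℝ) * (4 / 5) ^ n :=
    (summable_geometric_of_lt_one (by norm_num) (by norm_num)).mul_left _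
  refine Summable.of_norm_bounded_eventually_nat hgeom ?_
  have hQ := tendsto_cfDen_atTop hα
  have hlog := Real.tendsto_log_atTop.comp hQ
  have hlog₂ := Real.tendsto_log_atTop.comp
    (Real.tendsto_log_atTop.comp (hQ.comp (tendsto_add_atTop_nat 1)))
  have hθ : (2 + 3 * ε) / (2 + 4 * ε) < 1 := by
    rw [div_lt_one (by positivity)]
    linarith
  filter_upwards [hQ.eventually_gt_atTop 0, hlog.eventually_gt_atTop 0,
    hlog₂.eventually_gt_atTop 1, hlog.eventually (eventually_rpow_le_half hθ)]
    with n hn0 hx hy hxθ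
  simp only [Function.comp_apply] at hx hy hxθ
  by_cases hmem : n ∈ S
  swap
  · rw [Set.indicator_of_notMem hmem, norm_zero]
    positivity
  rw [Set.indicator_of_mem hmem, Real.norm_of_nonneg (by positivity)]
  simp only [hS, Set.mem_ofPred_eq] at hmem
  set x := Real.log (cfDen α n)
  set y := Real.log (Real.log (cfDen α (n + 1)))
  have hlogy : Real.log y ≤ x / 2 := by
    refine le_trans (le_of_lt ?_) hxθ
    rw [← Real.rpow_lt_rpow_iff (Real.log_pos hy).le (by positivity)
      (show (0 : ℝ) < 2 + 4 * ε by positivity), ← Real.rpow_mul hx.le,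
      div_mul_cancel₀ _ (by positivity)]
    exact hmem
  have hexp : Real.exp (x / 2) * Real.exp (x / 2) = cfDen α n := by
    rw [← Real.exp_add, add_halves, Real.exp_log hn0]
  have hyle : y ≤ Real.exp (x / 2) := (Real.log_le_iff_le_exp (by positivity)).mp hlogy
  have hlower : (4 / 5 : ℝ) * (5 / 4) ^ n ≤ Real.exp (x / 2) := by
    refine le_of_sq_le_sq ?_ (Real.exp_pos _).le
    calc ((4 / 5 : ℝ) * (5 / 4) ^ n) ^ 2 = 16 / 25 * (25 / 16) ^ n := by
          rw [mul_pow, ← pow_mul, mul_comm n, pow_mul]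
          norm_num
      _ ≤ cfDen α n := pow_le_cfDen hα n
      _ = Real.exp (x / 2) ^ 2 := by rw [sq, hexp]
  calc y / cfDen α n ≤ Real.exp (x / 2) / cfDen α n := by gcongr
    _ = (Real.exp (x / 2))⁻¹ := by
      rw [← hexp]
      field_simp
    _ ≤ ((4 / 5 : ℝ) * (5 / 4) ^ n)⁻¹ := by gcongr
    _ = 5 / 4 * (4 / 5) ^ n := by
      rw [mul_inv, ← inv_pow]
      norm_num
end
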